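/- arXiv:1602.06235 — 10 statements merged into one kernel-verified Lean document; each statement's English description precedes it below -/
import Mathlib

section
/- Let P₁, …, P_L be probability distributions on a measurable space (X, 𝒞), let Π be an M×L row-stochastic matrix, and let P̃_i = ∑_{j=1}^L Π_{i,j} P_j for i = 1, …, M be the contaminated distributions. Assume there exists a probability distribution on (X, 𝒞) that does not belong to co(P₁, …, P_L), and assume there exist an index i ∈ {1, …, L} and a distribution Q ∈ co({P_j : j ≠ i}) such that P_i is NOT irreducible with respect to Q. Then there exist an M×L row-stochastic matrix Π′ and probability distributions P′₁, …, P′_L with P̃_k = ∑_{j=1}^L Π′_{k,j} P′_j for every k = 1, …, M, such that not every P′_j belongs to co(P₁, …, P_L). -/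
open MeasureTheory

section ConvexHull

variable {E : Type*} [AddCommGroup E] [Module ℝ E]

/-- Points of the convex hull of a finite family are convex combinations of the family. -/
theorem exists_weights_of_mem_convexHull_range {ι : Type*} [Fintype ι] {y : ι → E} {z : E}
    (hz : z ∈ convexHull ℝ (Set.range y)) :
    ∃ w : ι → ℝ, (∀ j, 0 ≤ w j) ∧ ∑ j, w j = 1 ∧ ∑ j, w j • y j = z := by
  classical
  have hrange : Set.range y =
      (Fintype.linearCombination ℝ y) '' Set.range fun j k : ι => if j = k then (1 : ℝ) else 0 := by
    rw [← Set.range_comp]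
    congr 1
    ext j
    simp [Fintype.linearCombination_apply]
  rw [hrange, ← LinearMap.image_convexHull, convexHull_basis_eq_stdSimplex] at hz
  obtain ⟨w, hw, rfl⟩ := hz
  exact ⟨w, hw.1, hw.2, (Fintype.linearCombination_apply ℝ y w).symm⟩

/-- If `a = γ q + (1 - γ) g` with `q ∈ co s` and `g ∈ co (s ∪ {a})`, then `a ∈ co s`. -/
theorem mem_convexHull_of_eq_combination_of_mem_insert {s : Set E} {a q g : E} {γ : ℝ}
    (hq : q ∈ convexHull ℝ s) (hγ : 0 < γ) (hγ1 : γ ≤ 1) (ha : a = γ • q + (1 - γ) • g)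
    (hg : g ∈ convexHull ℝ (insert a s)) : a ∈ convexHull ℝ s := by
  have hs : s.Nonempty := convexHull_nonempty_iff.1 ⟨q, hq⟩
  rw [convexHull_insert hs, mem_convexJoin] at hg
  obtain ⟨b, hb, c, hc, u, v, hu, hv, huv, rfl⟩ := hg
  obtain rfl : a = b := hb.symm
  obtain rfl : u = 1 - v := by linarith
  have hv' : 0 ≤ (1 - γ) * v := mul_nonneg (by linarith) hv
  have ht : 0 < γ + (1 - γ) * v := by linarith
  have hcomb : (γ + (1 - γ) * v) • a = γ • q + ((1 - γ) * v) • c := by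
    calc (γ + (1 - γ) * v) • a = a - ((1 - γ) * (1 - v)) • a := by module
      _ = γ • q + (1 - γ) • ((1 - v) • a + v • c) - ((1 - γ) * (1 - v)) • a := by rw [← ha]
      _ = γ • q + ((1 - γ) * v) • c := by module
  have hmem := (convex_convexHull ℝ s) hq hc (div_nonneg hγ.le ht.le) (div_nonneg hv' ht.le)
    (by rw [← add_div, div_self ht.ne'])
  convert hmem using 1
  rw [div_eq_inv_mul, div_eq_inv_mul, mul_smul, mul_smul _ ((1 - γ) * v), ← smul_add, ← hcomb,
    inv_smul_smul₀ ht.ne']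

/-- If `x i` is a nontrivial mixture of `g` with a point of the convex hull of the other `x j`,
then `x i` may be replaced by one of `g` and `r`, lying outside the convex hull of the family,
so that the old `x i` lies in the convex hull of the new family. -/
theorem exists_update_mem_convexHull {ι : Type*} [DecidableEq ι] {x : ι → E} {i : ι} {q g r : E}
    {γ : ℝ} (hr : r ∉ convexHull ℝ (Set.range x)) (hq : q ∈ convexHull ℝ (x '' {j | j ≠ i}))
    (hγ : 0 < γ) (hγ1 : γ ≤ 1) (hx : x i = γ • q + (1 - γ) • g) :
    ∃ h, (h = g ∨ h = r) ∧ h ∉ convexHull ℝ (Set.range x) ∧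
      x i ∈ convexHull ℝ (Set.range (Function.update x i h)) := by
  have hsub (h : E) : x '' {j | j ≠ i} ⊆ Set.range (Function.update x i h) := by
    rintro _ ⟨j, hj, rfl⟩
    exact ⟨j, Function.update_of_ne hj _ _⟩
  by_cases hg : g ∈ convexHull ℝ (Set.range x)
  · refine ⟨r, Or.inr rfl, hr, convexHull_mono (hsub r) ?_⟩
    refine mem_convexHull_of_eq_combination_of_mem_insert hq hγ hγ1 hx (convexHull_mono ?_ hg)
    rintro _ ⟨j, rfl⟩
    by_cases hj : j = i
    · exact Or.inl (congrArg x hj)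
    · exact Or.inr ⟨j, hj, rfl⟩
  · refine ⟨g, Or.inl rfl, hg, ?_⟩
    have hg' : g ∈ convexHull ℝ (Set.range (Function.update x i g)) :=
      subset_convexHull ℝ _ ⟨i, Function.update_self _ _ _⟩
    have hmem := (convex_convexHull ℝ _) (convexHull_mono (hsub g) hq) hg' hγ.le
      (sub_nonneg.2 hγ1) (by ring)
    rwa [← hx] at hmem

end ConvexHull

/-- If some probability distribution lies outside `co(P₁, …, P_L)` and some
`P i` fails to be irreducible with respect to a distribution `Q ∈ co({P j : j ≠ i})`, then the
mutual contamination model `P̃ = Π P` admits another solution `(Π', P')` with not all `P' j`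
inside `co(P₁, …, P_L)`. -/
theorem stmt0 {X : Type*} [MeasurableSpace X] {L M : ℕ}
    (P : Fin L → Measure X) [∀ j, IsProbabilityMeasure (P j)]
    (Pi0 : Matrix (Fin M) (Fin L) ℝ)
    (hPi0nonneg : ∀ i j, 0 ≤ Pi0 i j) (hPi0row : ∀ i, ∑ j, Pi0 i j = 1)
    (hR : ∃ (R : Measure X) (_ : IsProbabilityMeasure R),
      R.toSignedMeasure ∉ convexHull ℝ (Set.range fun j => (P j).toSignedMeasure))
    (hnotirr : ∃ (i : Fin L) (Q : Measure X) (_ : IsProbabilityMeasure Q),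
      Q.toSignedMeasure ∈ convexHull ℝ ((fun j => (P j).toSignedMeasure) '' {j | j ≠ i}) ∧
      ∃ γ : ℝ, 0 < γ ∧ γ ≤ 1 ∧ ∃ (G : Measure X) (_ : IsProbabilityMeasure G),
        (P i).toSignedMeasure = γ • Q.toSignedMeasure + (1 - γ) • G.toSignedMeasure) :
    ∃ (Pi1 : Matrix (Fin M) (Fin L) ℝ) (P' : Fin L → Measure X)
      (_ : ∀ j, IsProbabilityMeasure (P' j)),
      (∀ i j, 0 ≤ Pi1 i j) ∧ (∀ i, ∑ j, Pi1 i j = 1) ∧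
      (∀ k, ∑ j, Pi0 k j • (P j).toSignedMeasure
          = ∑ j, Pi1 k j • (P' j).toSignedMeasure) ∧
      ¬ (∀ j, (P' j).toSignedMeasure ∈
          convexHull ℝ (Set.range fun j' => (P j').toSignedMeasure)) := by
  classical
  obtain ⟨R, hRprob, hR⟩ := hR
  obtain ⟨i, Q, _, hQ, γ, hγ, hγ1, G, hGprob, hG⟩ := hnotirr
  obtain ⟨h, hh, hnot, hmem⟩ := exists_update_mem_convexHull hR hQ hγ hγ1 hG
  obtain ⟨H, hH, rfl⟩ : ∃ (H : Measure X) (_ : IsProbabilityMeasure H), H.toSignedMeasure = h := by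
    rcases hh with rfl | rfl
    exacts [⟨G, hGprob, rfl⟩, ⟨R, hRprob, rfl⟩]
  have hprob (j : Fin L) : IsProbabilityMeasure (Function.update P i H j) := by
    by_cases hj : j = i
    · subst hj; simpa using hH
    · rw [Function.update_of_ne hj]; infer_instance
  have hupd (j : Fin L) : (Function.update P i H j).toSignedMeasure =
      Function.update (fun j => (P j).toSignedMeasure) i H.toSignedMeasure j := by
    by_cases hj : j = i
    · subst hj
      rw [Measure.toSignedMeasure_congr (Function.update_self j H P), Function.update_self]
    · rw [Measure.toSignedMeasure_congr (Function.update_of_ne hj H P), Function.update_of_ne hj]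
  have hP (j : Fin L) : (P j).toSignedMeasure ∈ convexHull ℝ
      (Set.range (Function.update (fun j => (P j).toSignedMeasure) i H.toSignedMeasure)) := by
    by_cases hj : j = i
    · subst hj; exact hmem
    · exact subset_convexHull ℝ _ ⟨j, Function.update_of_ne hj _ _⟩
  have hrow (k : Fin M) := exists_weights_of_mem_convexHull_range <|
    (convex_convexHull ℝ _).sum_mem (fun j _ => hPi0nonneg k j) (hPi0row k) fun j _ => hP j
  choose w hw hw1 hwsum using hrow
  refine ⟨w, Function.update P i H, hprob, hw, hw1, fun k => ?_, fun hall => hnot ?_⟩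
  · simp_rw [hupd]
    exact (hwsum k).symm
  · have hi := hall i
    rwa [hupd, Function.update_self] at hi
end

section
/- Let P₁, …, P_L be jointly irreducible probability distributions, let Π be an M×L row-stochastic matrix of rank L, and let P̃_i = ∑_{j=1}^L Π_{i,j} P_j for i = 1, …, M. Then: (i) span(P̃₁, …, P̃_M) = span(P₁, …, P_L) in the space of finite signed measures; and (ii) for every M×L row-stochastic matrix Π′ and probability distributions P′₁, …, P′_L with P̃_i = ∑_{j=1}^L Π′_{i,j} P′_j for every i = 1, …, M, each P′_j belongs to co(P₁, …, P_L). -/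
open MeasureTheory

/-- Probability distributions `P₁, …, P_L` are *jointly irreducible* if whenever a real linear
combination `∑ γᵢ Pᵢ` (in the space of finite signed measures) is a probability distribution,
all coefficients `γᵢ` are nonnegative. -/
def JointlyIrreducible {X : Type*} [MeasurableSpace X] {L : ℕ}
    (P : Fin L → Measure X) [∀ j, IsProbabilityMeasure (P j)] : Prop :=
  ∀ (γ : Fin L → ℝ) (Q : Measure X) (_ : IsProbabilityMeasure Q),
    Q.toSignedMeasure = ∑ i, γ i • (P i).toSignedMeasure → ∀ i, 0 ≤ γ i

/-- Applying two matrices in succession to a family of vectors is applying their product. -/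
theorem Matrix.sum_smul_sum_smul {l m n R V : Type*} [Fintype m] [Fintype n] [Semiring R]
    [AddCommMonoid V] [Module R V] (A : Matrix l m R) (B : Matrix m n R) (v : n → V) (i : l) :
    ∑ j, A i j • ∑ k, B j k • v k = ∑ k, (A * B) i k • v k := by
  simp only [Finset.smul_sum, smul_smul, Matrix.mul_apply, Finset.sum_smul]
  exact Finset.sum_comm

/-- The identity matrix fixes every family of vectors. -/
theorem Matrix.sum_one_smul {n R V : Type*} [Fintype n] [DecidableEq n] [Semiring R]
    [AddCommMonoid V] [Module R V] (v : n → V) (i : n) :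
    ∑ j, (1 : Matrix n n R) i j • v j = v i := by
  simp [Matrix.one_apply, ite_smul]

/-- A matrix of full column rank over a field has a left inverse. -/
theorem Matrix.exists_mul_eq_one_of_rank_eq_card {m n K : Type*} [Fintype m] [Fintype n]
    [DecidableEq n] [Field K] (A : Matrix m n K) (hA : A.rank = Fintype.card n) :
    ∃ B : Matrix n m K, B * A = 1 := by
  classical
  rw [← Matrix.vecMul_surjective_iff_exists_left_inverse]
  have htop : LinearMap.range A.transpose.mulVecLin = ⊤ := by
    apply Submodule.eq_top_of_finrank_eq
    rw [Module.finrank_fintype_fun_eq_card, ← hA, ← Matrix.rank_transpose]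
    rfl
  intro w
  obtain ⟨v, hv⟩ := LinearMap.range_eq_top.mp htop w
  exact ⟨v, by simpa [Matrix.mulVec_transpose] using hv⟩

/-- Jointly irreducible distributions are linearly independent signed measures. -/
theorem JointlyIrreducible.linearIndependent {X : Type*} [MeasurableSpace X] {L : ℕ}
    {P : Fin L → Measure X} [∀ j, IsProbabilityMeasure (P j)] (h : JointlyIrreducible P) :
    LinearIndependent ℝ fun j => (P j).toSignedMeasure := by
  rw [Fintype.linearIndependent_iff]
  intro γ hγ i
  have key (t : ℝ) : 0 ≤ 1 + t * γ i := by
    have := h (fun k => (if i = k then 1 else 0) + t * γ k) (P i) inferInstance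
      (by simp [add_smul, Finset.sum_add_distrib, mul_smul, ← Finset.smul_sum, hγ]) i
    simpa using this
  by_contra hne
  have := key (-2 / γ i)
  rw [div_mul_cancel₀ _ hne] at this
  norm_num at this

/-- If `P₁, …, P_L` are jointly irreducible and `Π` is row-stochastic of rank
`L`, then (i) `span(P̃₁, …, P̃_M) = span(P₁, …, P_L)`, and (ii) every row-stochastic solution
`(Π', P')` of `P̃ = Π' P'` has all `P'ⱼ` in `co(P₁, …, P_L)`. -/
theorem stmt3 {X : Type*} [MeasurableSpace X] {L M : ℕ}
    (P : Fin L → Measure X) [∀ j, IsProbabilityMeasure (P j)]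
    (hJI : JointlyIrreducible P)
    (Pi0 : Matrix (Fin M) (Fin L) ℝ)
    (hPi0nonneg : ∀ i j, 0 ≤ Pi0 i j) (hPi0row : ∀ i, ∑ j, Pi0 i j = 1)
    (hrank : Pi0.rank = L) :
    Submodule.span ℝ (Set.range fun i => ∑ j, Pi0 i j • (P j).toSignedMeasure)
      = Submodule.span ℝ (Set.range fun j => (P j).toSignedMeasure) ∧
    ∀ (Pi1 : Matrix (Fin M) (Fin L) ℝ) (P' : Fin L → Measure X)
      (_ : ∀ j, IsProbabilityMeasure (P' j)),
      (∀ i j, 0 ≤ Pi1 i j) → (∀ i, ∑ j, Pi1 i j = 1) →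
      (∀ i, ∑ j, Pi0 i j • (P j).toSignedMeasure
          = ∑ j, Pi1 i j • (P' j).toSignedMeasure) →
      ∀ j, (P' j).toSignedMeasure ∈
        convexHull ℝ (Set.range fun j' => (P j').toSignedMeasure) := by
  obtain ⟨B, hB⟩ := Pi0.exists_mul_eq_one_of_rank_eq_card (by simpa using hrank)
  have hPB (j : Fin L) : ∑ i, B j i • ∑ k, Pi0 i k • (P k).toSignedMeasure
      = (P j).toSignedMeasure := by
    rw [Matrix.sum_smul_sum_smul, hB, Matrix.sum_one_smul]
  refine ⟨le_antisymm ?_ ?_, ?_⟩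
  · rw [Submodule.span_le]
    rintro _ ⟨i, rfl⟩
    exact Submodule.sum_mem _ fun j _ =>
      Submodule.smul_mem _ _ (Submodule.subset_span ⟨j, rfl⟩)
  · rw [Submodule.span_le]
    rintro _ ⟨j, rfl⟩
    simp only [← hPB j]
    exact Submodule.sum_mem _ fun i _ =>
      Submodule.smul_mem _ _ (Submodule.subset_span ⟨i, rfl⟩)
  · intro Pi1 P' hP' _ _ heq j
    have hC (k : Fin L) : (P k).toSignedMeasure
        = ∑ l, (B * Pi1) k l • (P' l).toSignedMeasure := by
      rw [← hPB k, ← Matrix.sum_smul_sum_smul]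
      simp only [heq]
    have hunit : IsUnit (B * Pi1) := by
      rw [← Matrix.vecMul_injective_iff_isUnit]
      refine (injective_iff_map_eq_zero (B * Pi1).vecMulLinear).mpr ?_
      intro v hv
      funext k
      refine Fintype.linearIndependent_iff.mp hJI.linearIndependent v ?_ k
      simp only [hC, Finset.smul_sum, smul_smul]
      rw [Finset.sum_comm]
      refine Finset.sum_eq_zero fun l _ => ?_
      rw [← Finset.sum_smul]
      have hl : ∑ i, v i * (B * Pi1) i l = 0 := congrFun hv l
      rw [hl, zero_smul]
    obtain ⟨D, hD⟩ := hunit.exists_left_inv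
    have hPD : (P' j).toSignedMeasure = ∑ k, D j k • (P k).toSignedMeasure := by
      simp only [hC]
      rw [Matrix.sum_smul_sum_smul, hD, Matrix.sum_one_smul]
    have hsum : ∑ k, D j k = 1 := by
      have := congrArg (fun μ : SignedMeasure X => μ Set.univ) hPD
      simpa [FunLike.coe_smul, Measure.toSignedMeasure_apply_measurable] using this.symm
    rw [hPD]
    exact (convex_convexHull ℝ _).sum_mem (fun k _ => hJI (D j) (P' j) (hP' j) hPD k) hsum
      fun k _ => subset_convexHull ℝ _ ⟨k, rfl⟩
end

section
/- Let F₀ and F₁ be probability distributions on a measurable space (X, 𝒞) with F₀ ≠ F₁. Then: (i) κ*(F₀ | F₁) < 1; (ii) the supremum defining κ*(F₀ | F₁) is attained, and there is a unique probability distribution G with F₀ = (1−κ*)G + κ*F₁ where κ* = κ*(F₀ | F₁); and (iii) κ*(F₀ | F₁) = inf{F₀(C)/F₁(C) : C ∈ 𝒞, F₁(C) > 0}. -/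
open MeasureTheory

/-- The two-sample operator
`κ*(F₀ | F₁) = sup {κ ∈ [0,1] : ∃ probability G, F₀ = (1−κ)G + κF₁}`. -/
noncomputable def kappaTwo {X : Type*} [MeasurableSpace X]
    (F₀ F₁ : Measure X) [IsFiniteMeasure F₀] [IsFiniteMeasure F₁] : ℝ :=
  sSup {κ : ℝ | κ ∈ Set.Icc (0 : ℝ) 1 ∧ ∃ (G : Measure X) (_ : IsProbabilityMeasure G),
    F₀.toSignedMeasure = (1 - κ) • G.toSignedMeasure + κ • F₁.toSignedMeasure}

/-- The ratios `F₀(C) / F₁(C)` over measurable sets `C` with `F₁(C) > 0`. -/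
def measureRatios {X : Type*} [MeasurableSpace X] (F₀ F₁ : Measure X) : Set ℝ :=
  {r : ℝ | ∃ C : Set X, MeasurableSet C ∧ 0 < F₁ C ∧ r = (F₀ C).toReal / (F₁ C).toReal}

section

variable {X : Type*} [MeasurableSpace X]

lemma nonneg_of_mem_measureRatios {F₀ F₁ : Measure X} {r : ℝ} (hr : r ∈ measureRatios F₀ F₁) :
    0 ≤ r := by
  obtain ⟨C, -, -, rfl⟩ := hr
  positivity

lemma bddBelow_measureRatios (F₀ F₁ : Measure X) : BddBelow (measureRatios F₀ F₁) :=
  ⟨0, fun _ => nonneg_of_mem_measureRatios⟩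

lemma sInf_measureRatios_nonneg (F₀ F₁ : Measure X) : 0 ≤ sInf (measureRatios F₀ F₁) :=
  Real.sInf_nonneg fun _ => nonneg_of_mem_measureRatios

lemma sInf_measureRatios_mul_le (F₀ F₁ : Measure X) [IsFiniteMeasure F₁]
    {C : Set X} (hC : MeasurableSet C) :
    sInf (measureRatios F₀ F₁) * F₁.real C ≤ F₀.real C := by
  rcases eq_or_ne (F₁ C) 0 with h | h
  · simp [Measure.real, h]
  · have hpos : 0 < F₁.real C := ENNReal.toReal_pos h (measure_ne_top _ _)
    rw [← le_div_iff₀ hpos]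
    exact csInf_le (bddBelow_measureRatios F₀ F₁) ⟨C, hC, pos_iff_ne_zero.2 h, rfl⟩

lemma exists_measureReal_lt_of_ne {F₀ F₁ : Measure X} [IsProbabilityMeasure F₀]
    [IsProbabilityMeasure F₁] (hne : F₀ ≠ F₁) :
    ∃ C, MeasurableSet C ∧ F₀.real C < F₁.real C := by
  by_contra! h
  refine hne (Measure.ext fun C hC => ?_)
  have h₁ := h C hC
  have h₂ := h Cᶜ hC.compl
  rw [probReal_compl_eq_one_sub hC, probReal_compl_eq_one_sub hC] at h₂
  exact (measureReal_eq_measureReal_iff).1 (by linarith)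

lemma sInf_measureRatios_lt_one {F₀ F₁ : Measure X} [IsProbabilityMeasure F₀]
    [IsProbabilityMeasure F₁] (hne : F₀ ≠ F₁) : sInf (measureRatios F₀ F₁) < 1 := by
  obtain ⟨C, hC, hlt⟩ := exists_measureReal_lt_of_ne hne
  have hpos : 0 < F₁.real C := measureReal_nonneg.trans_lt hlt
  exact (csInf_le (bddBelow_measureRatios F₀ F₁)
    ⟨C, hC, (ENNReal.toReal_pos_iff.1 hpos).1, rfl⟩).trans_lt ((div_lt_one hpos).2 hlt)

lemma toSignedMeasure_eq_mixture_iff {F₀ F₁ G : Measure X} [IsFiniteMeasure F₀]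
    [IsFiniteMeasure F₁] [IsFiniteMeasure G] {κ : ℝ} :
    F₀.toSignedMeasure = (1 - κ) • G.toSignedMeasure + κ • F₁.toSignedMeasure ↔
      ∀ C, MeasurableSet C → F₀.real C = (1 - κ) * G.real C + κ * F₁.real C := by
  constructor
  · intro h C hC
    simpa [Measure.toSignedMeasure_apply_measurable hC] using congrArg (fun v => v C) h
  · intro h
    ext C hC
    simpa [Measure.toSignedMeasure_apply_measurable hC] using h C hC

lemma exists_residue {F₀ F₁ : Measure X} [IsProbabilityMeasure F₀] [IsProbabilityMeasure F₁]
    {κ : ℝ} (h₀ : 0 ≤ κ) (h₁ : κ < 1)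
    (hle : ∀ C, MeasurableSet C → κ * F₁.real C ≤ F₀.real C) :
    ∃ (G : Measure X) (_ : IsProbabilityMeasure G),
      F₀.toSignedMeasure = (1 - κ) • G.toSignedMeasure + κ • F₁.toSignedMeasure := by
  have hpos : 0 < 1 - κ := sub_pos.2 h₁
  have hsmul (C : Set X) : (κ.toNNReal • F₁).real C = κ * F₁.real C := by
    rw [measureReal_nnreal_smul_apply, Real.coe_toNNReal κ h₀]
  have hsub : κ.toNNReal • F₁ ≤ F₀ := by
    refine Measure.le_iff.2 fun C hC => ?_
    rw [← ENNReal.toReal_le_toReal (measure_ne_top _ _) (measure_ne_top _ _)]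
    exact (hsmul C).trans_le (hle C hC)
  let G : Measure X := (1 - κ)⁻¹.toNNReal • (F₀ - κ.toNNReal • F₁)
  have hG (C : Set X) (hC : MeasurableSet C) :
      G.real C = (1 - κ)⁻¹ * (F₀.real C - κ * F₁.real C) := by
    rw [measureReal_nnreal_smul_apply, Real.coe_toNNReal _ (inv_nonneg.2 hpos.le), ← hsmul C,
      Measure.real, Measure.sub_apply hC hsub,
      ENNReal.toReal_sub_of_le (hsub C) (measure_ne_top _ _)]
    rfl
  have hprob : IsProbabilityMeasure G := by
    refine isProbabilityMeasure_iff_real.2 ?_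
    rw [hG _ MeasurableSet.univ]
    simp [hpos.ne']
  refine ⟨G, hprob, toSignedMeasure_eq_mixture_iff.2 fun C hC => ?_⟩
  rw [hG C hC, mul_inv_cancel_left₀ hpos.ne']
  ring

lemma residue_unique {F₀ F₁ G G' : Measure X} [IsFiniteMeasure F₀] [IsFiniteMeasure F₁]
    [IsFiniteMeasure G] [IsFiniteMeasure G'] {κ : ℝ} (hκ : κ ≠ 1)
    (h : F₀.toSignedMeasure = (1 - κ) • G.toSignedMeasure + κ • F₁.toSignedMeasure)
    (h' : F₀.toSignedMeasure = (1 - κ) • G'.toSignedMeasure + κ • F₁.toSignedMeasure) :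
    G = G' := by
  have heq := add_right_cancel (h.symm.trans h')
  rw [← Measure.toSignedMeasure_eq_toSignedMeasure_iff]
  exact (smul_right_inj (sub_ne_zero.2 hκ.symm)).1 heq

lemma le_sInf_measureRatios {F₀ F₁ G : Measure X} [IsFiniteMeasure F₀] [IsProbabilityMeasure F₁]
    [IsFiniteMeasure G] {κ : ℝ} (hκ : κ ≤ 1)
    (h : F₀.toSignedMeasure = (1 - κ) • G.toSignedMeasure + κ • F₁.toSignedMeasure) :
    κ ≤ sInf (measureRatios F₀ F₁) := by
  refine le_csInf ⟨_, Set.univ, MeasurableSet.univ, by simp, rfl⟩ ?_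
  rintro _ ⟨C, hC, hpos, rfl⟩
  rw [le_div_iff₀ (ENNReal.toReal_pos hpos.ne' (measure_ne_top _ _))]
  have := toSignedMeasure_eq_mixture_iff.1 h C hC
  have : 0 ≤ (1 - κ) * G.real C := mul_nonneg (sub_nonneg.2 hκ) measureReal_nonneg
  change κ * F₁.real C ≤ F₀.real C
  linarith

lemma kappaTwo_eq_sInf_measureRatios {F₀ F₁ : Measure X} [IsProbabilityMeasure F₀]
    [IsProbabilityMeasure F₁] (hne : F₀ ≠ F₁) :
    kappaTwo F₀ F₁ = sInf (measureRatios F₀ F₁) := by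
  have hlt := sInf_measureRatios_lt_one hne
  have hnonneg := sInf_measureRatios_nonneg F₀ F₁
  refine IsGreatest.csSup_eq ⟨⟨⟨hnonneg, hlt.le⟩, exists_residue hnonneg hlt fun _ =>
    sInf_measureRatios_mul_le F₀ F₁⟩, ?_⟩
  rintro κ ⟨hκ, G, hG, h⟩
  exact le_sInf_measureRatios hκ.2 h

end

/-- For probability distributions `F₀ ≠ F₁`: (i) `κ*(F₀|F₁) < 1`;
(ii) the supremum defining `κ*(F₀|F₁)` is attained by a unique probability distribution `G`
with `F₀ = (1−κ*)G + κ*F₁`; (iii) `κ*(F₀|F₁) = inf {F₀(C)/F₁(C) : C ∈ 𝒞, F₁(C) > 0}`. -/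
theorem stmt4 {X : Type*} [MeasurableSpace X]
    (F₀ F₁ : Measure X) [IsProbabilityMeasure F₀] [IsProbabilityMeasure F₁]
    (hne : F₀ ≠ F₁) :
    kappaTwo F₀ F₁ < 1 ∧
    (∃! G : ProbabilityMeasure X,
      F₀.toSignedMeasure = (1 - kappaTwo F₀ F₁) • (G : Measure X).toSignedMeasure
        + kappaTwo F₀ F₁ • F₁.toSignedMeasure) ∧
    kappaTwo F₀ F₁ = sInf {r : ℝ | ∃ C : Set X, MeasurableSet C ∧ 0 < F₁ C ∧
      r = (F₀ C).toReal / (F₁ C).toReal} := by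
  rw [kappaTwo_eq_sInf_measureRatios hne]
  have hlt := sInf_measureRatios_lt_one hne
  obtain ⟨G, hG, h⟩ := exists_residue (sInf_measureRatios_nonneg F₀ F₁) hlt fun _ =>
    sInf_measureRatios_mul_le F₀ F₁
  refine ⟨hlt, ⟨⟨G, hG⟩, h, fun G' h' => Subtype.ext ?_⟩, rfl⟩
  have := G'.2
  exact residue_unique hlt.ne h' h
end

section
/- Let F₁, …, F_K be jointly irreducible probability distributions, let η₁, η₂ ∈ Δ_K with η₁ ≠ η₂, and let Q_i = ∑_{k=1}^K η_{i,k} F_k for i = 1, 2. Then κ*(Q₁ | Q₂) < 1, the set {α ≥ 1 : the signed measure (1−α)Q₂ + αQ₁ is a probability distribution} has a maximum element, and this maximum equals 1/(1 − κ*(Q₁ | Q₂)). -/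
open MeasureTheory

theorem MeasureTheory.SignedMeasure.exists_isProbabilityMeasure {X : Type*} [MeasurableSpace X]
    (s : SignedMeasure X) (h_nonneg : ∀ A, MeasurableSet A → 0 ≤ s A) (h_univ : s Set.univ = 1) :
    ∃ (G : Measure X) (_ : IsProbabilityMeasure G), G.toSignedMeasure = s := by
  have hs : VectorMeasure.restrict 0 Set.univ ≤ VectorMeasure.restrict s Set.univ := by
    rw [VectorMeasure.restrict_univ, VectorMeasure.restrict_univ, VectorMeasure.le_iff]
    simpa using h_nonneg
  have hG : (s.toMeasureOfZeroLE Set.univ MeasurableSet.univ hs).toSignedMeasure = s := by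
    rw [SignedMeasure.toMeasureOfZeroLE_toSignedMeasure]
  refine ⟨s.toMeasureOfZeroLE Set.univ MeasurableSet.univ hs, ⟨?_⟩, hG⟩
  have h := congrArg (fun v : SignedMeasure X => v Set.univ) hG
  simp only [Measure.toSignedMeasure_apply_measurable MeasurableSet.univ, h_univ] at h
  rwa [measureReal_def, ENNReal.toReal_eq_one_iff] at h

theorem toSignedMeasure_eq_of_real_le {X : Type*} [MeasurableSpace X] {P Q : Measure X}
    [IsProbabilityMeasure P] [IsProbabilityMeasure Q]
    (h : ∀ A, MeasurableSet A → P.real A ≤ Q.real A) :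
    P.toSignedMeasure = Q.toSignedMeasure := by
  ext A hA
  rw [Measure.toSignedMeasure_apply_measurable hA, Measure.toSignedMeasure_apply_measurable hA]
  have h₁ := h A hA
  have h₂ := h Aᶜ hA.compl
  rw [probReal_compl_eq_one_sub hA, probReal_compl_eq_one_sub hA] at h₂
  linarith

theorem kappaTwo_set_eq {X : Type*} [MeasurableSpace X] (P Q : Measure X)
    [IsProbabilityMeasure P] [IsProbabilityMeasure Q] :
    {κ : ℝ | κ ∈ Set.Icc (0 : ℝ) 1 ∧ ∃ (G : Measure X) (_ : IsProbabilityMeasure G),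
      P.toSignedMeasure = (1 - κ) • G.toSignedMeasure + κ • Q.toSignedMeasure} =
    {κ : ℝ | κ ∈ Set.Icc (0 : ℝ) 1 ∧ ∀ A, MeasurableSet A → κ * Q.real A ≤ P.real A} := by
  ext κ
  refine and_congr_right fun hκ => ⟨?_, fun h => ?_⟩
  · rintro ⟨G, _, hG⟩ A hA
    have h := congrArg (fun v : SignedMeasure X => v A) hG
    simp only [add_apply, smul_apply, smul_eq_mul,
      Measure.toSignedMeasure_apply_measurable hA] at h
    have := mul_nonneg (sub_nonneg.2 hκ.2) (measureReal_nonneg (μ := G) (s := A))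
    linarith
  · rcases hκ.2.lt_or_eq with hlt | rfl
    · have hpos : 0 < 1 - κ := sub_pos.2 hlt
      obtain ⟨G, hG, hGs⟩ := SignedMeasure.exists_isProbabilityMeasure
        ((1 - κ)⁻¹ • (P.toSignedMeasure - κ • Q.toSignedMeasure))
        (fun A hA => by
          simp only [sub_apply, smul_apply, smul_eq_mul,
            Measure.toSignedMeasure_apply_measurable hA]
          exact mul_nonneg (inv_nonneg.2 hpos.le) (sub_nonneg.2 (h A hA)))
        (by
          simp only [sub_apply, smul_apply, smul_eq_mul,
            Measure.toSignedMeasure_apply_measurable MeasurableSet.univ, probReal_univ, mul_one]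
          exact inv_mul_cancel₀ hpos.ne')
      refine ⟨G, hG, ?_⟩
      rw [hGs, smul_inv_smul₀ hpos.ne', sub_add_cancel]
    · refine ⟨P, inferInstance, ?_⟩
      rw [toSignedMeasure_eq_of_real_le (P := Q) (Q := P) fun A hA => by simpa using h A hA]
      simp

theorem kappaTwo_mem {X : Type*} [MeasurableSpace X] (P Q : Measure X)
    [IsProbabilityMeasure P] [IsProbabilityMeasure Q] :
    kappaTwo P Q ∈
      {κ : ℝ | κ ∈ Set.Icc (0 : ℝ) 1 ∧ ∀ A, MeasurableSet A → κ * Q.real A ≤ P.real A} := by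
  rw [kappaTwo, kappaTwo_set_eq]
  have hclosed : IsClosed {κ : ℝ | ∀ A, MeasurableSet A → κ * Q.real A ≤ P.real A} := by
    simp only [Set.ofPred_forall]
    exact isClosed_iInter fun A => isClosed_iInter fun _ =>
      isClosed_le (continuous_id.mul continuous_const) continuous_const
  exact IsCompact.sSup_mem (isCompact_Icc.inter_right hclosed) ⟨0, by simp⟩

theorem le_kappaTwo {X : Type*} [MeasurableSpace X] {P Q : Measure X}
    [IsProbabilityMeasure P] [IsProbabilityMeasure Q] {κ : ℝ} (hκ : κ ∈ Set.Icc (0 : ℝ) 1)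
    (h : ∀ A, MeasurableSet A → κ * Q.real A ≤ P.real A) : κ ≤ kappaTwo P Q := by
  rw [kappaTwo, kappaTwo_set_eq]
  exact le_csSup ⟨1, fun _ hx => hx.1.2⟩ ⟨hκ, h⟩

theorem kappaTwo_lt_one {X : Type*} [MeasurableSpace X] {P Q : Measure X}
    [IsProbabilityMeasure P] [IsProbabilityMeasure Q]
    (h : P.toSignedMeasure ≠ Q.toSignedMeasure) : kappaTwo P Q < 1 := by
  obtain ⟨hIcc, hle⟩ := kappaTwo_mem P Q
  refine hIcc.2.lt_of_ne fun heq => h (toSignedMeasure_eq_of_real_le fun A hA => ?_).symm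
  simpa [heq] using hle A hA

/-- The coefficients of a probability distribution with respect to jointly irreducible
distributions are unique. -/
theorem JointlyIrreducible.coeff_unique {X : Type*} [MeasurableSpace X] {L : ℕ}
    {P : Fin L → Measure X} [∀ j, IsProbabilityMeasure (P j)] (hP : JointlyIrreducible P)
    {Q : Measure X} [IsProbabilityMeasure Q] {a b : Fin L → ℝ}
    (ha : Q.toSignedMeasure = ∑ i, a i • (P i).toSignedMeasure)
    (hb : Q.toSignedMeasure = ∑ i, b i • (P i).toSignedMeasure) : a = b := by
  have hline (t : ℝ) (i : Fin L) : 0 ≤ a i + t * (a i - b i) := by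
    refine hP (fun i => a i + t * (a i - b i)) Q inferInstance ?_ i
    simp only [add_smul, mul_smul, sub_smul, Finset.sum_add_distrib, ← Finset.smul_sum,
      Finset.sum_sub_distrib]
    rw [← ha, ← hb, sub_self, smul_zero, add_zero]
  ext i
  by_contra hne
  have hd : a i - b i ≠ 0 := sub_ne_zero.2 hne
  have h := hline (-(a i + 1) / (a i - b i)) i
  rw [div_mul_cancel₀ _ hd] at h
  linarith

/-- For `Q₁ ≠ Q₂` given by simplex combinations of jointly irreducible
`F₁, …, F_K`: `κ*(Q₁ | Q₂) < 1` and the set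
`{α ≥ 1 : (1−α)Q₂ + αQ₁ is a probability distribution}` has maximum `1/(1 − κ*(Q₁ | Q₂))`. -/
theorem stmt6 {X : Type*} [MeasurableSpace X] {K : ℕ}
    (F : Fin K → Measure X) [∀ k, IsProbabilityMeasure (F k)]
    (hJI : JointlyIrreducible F)
    (η₁ η₂ : Fin K → ℝ) (hη₁ : η₁ ∈ stdSimplex ℝ (Fin K)) (hη₂ : η₂ ∈ stdSimplex ℝ (Fin K))
    (hne : η₁ ≠ η₂)
    (Q₁ Q₂ : Measure X) [IsProbabilityMeasure Q₁] [IsProbabilityMeasure Q₂]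
    (hQ₁ : Q₁.toSignedMeasure = ∑ k, η₁ k • (F k).toSignedMeasure)
    (hQ₂ : Q₂.toSignedMeasure = ∑ k, η₂ k • (F k).toSignedMeasure) :
    kappaTwo Q₁ Q₂ < 1 ∧
    IsGreatest {α : ℝ | 1 ≤ α ∧ ∃ (G : Measure X) (_ : IsProbabilityMeasure G),
        G.toSignedMeasure = (1 - α) • Q₂.toSignedMeasure + α • Q₁.toSignedMeasure}
      (1 / (1 - kappaTwo Q₁ Q₂)) := by
  have hne' : Q₁.toSignedMeasure ≠ Q₂.toSignedMeasure := fun h =>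
    hne (hJI.coeff_unique hQ₁ (h.trans hQ₂))
  have hlt := kappaTwo_lt_one hne'
  refine ⟨hlt, ?_⟩
  obtain ⟨hIcc, hle⟩ := kappaTwo_mem Q₁ Q₂
  have hpos : 0 < 1 - kappaTwo Q₁ Q₂ := sub_pos.2 hlt
  refine ⟨⟨?_, ?_⟩, ?_⟩
  · rw [le_div_iff₀ hpos]
    linarith [hIcc.1]
  · obtain ⟨G, hG, hGs⟩ := SignedMeasure.exists_isProbabilityMeasure
      ((1 - 1 / (1 - kappaTwo Q₁ Q₂)) • Q₂.toSignedMeasure +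
        (1 / (1 - kappaTwo Q₁ Q₂)) • Q₁.toSignedMeasure)
      (fun A hA => by
        simp only [add_apply, smul_apply, smul_eq_mul,
          Measure.toSignedMeasure_apply_measurable hA]
        have heq : (1 - 1 / (1 - kappaTwo Q₁ Q₂)) * Q₂.real A +
            1 / (1 - kappaTwo Q₁ Q₂) * Q₁.real A =
            (Q₁.real A - kappaTwo Q₁ Q₂ * Q₂.real A) / (1 - kappaTwo Q₁ Q₂) := by
          field_simp
          ring
        rw [heq]
        exact div_nonneg (sub_nonneg.2 (hle A hA)) hpos.le)
      (by simp [Measure.toSignedMeasure_apply_measurable MeasurableSet.univ])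
    exact ⟨G, hG, hGs⟩
  · rintro α ⟨hα, G, _, hG⟩
    have hα₀ : 0 < α := zero_lt_one.trans_le hα
    have hκ : 1 - 1 / α ≤ kappaTwo Q₁ Q₂ := by
      refine le_kappaTwo ⟨sub_nonneg.2 ((div_le_one hα₀).2 hα), by
        linarith [one_div_pos.2 hα₀]⟩ fun A hA => ?_
      have h := congrArg (fun v : SignedMeasure X => v A) hG
      simp only [add_apply, smul_apply, smul_eq_mul,
        Measure.toSignedMeasure_apply_measurable hA] at h
      have heq : Q₁.real A - (1 - 1 / α) * Q₂.real A = G.real A / α := by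
        rw [h]
        field_simp
        ring
      exact sub_nonneg.1 (heq ▸ div_nonneg measureReal_nonneg hα₀.le)
    rw [le_one_div hα₀ hpos]
    linarith
end

section
/- Let η₁, η₂, η₃ ∈ Δ_L be distinct and let (α_n) be a sequence in [0,1] with α_n → 1. Then κ*(α_n η₂ + (1−α_n) η₃ | η₁) → κ*(η₂ | η₁) as n → ∞, where elements of Δ_L are regarded as probability distributions on {1, …, L}. -/
open Filter

/-- The two-sample operator `κ*(a | b)` for elements of the simplex `Δ_L`, regarded as
probability distributions on `{1, …, L}`:
`κ*(a | b) = sup {κ ∈ [0,1] : ∃ g ∈ Δ_L, a = (1−κ)g + κb}`. -/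
noncomputable def kappaTwoVec {L : ℕ} (a b : Fin L → ℝ) : ℝ :=
  sSup {κ : ℝ | κ ∈ Set.Icc (0 : ℝ) 1 ∧ ∃ g ∈ stdSimplex ℝ (Fin L),
    a = (1 - κ) • g + κ • b}

/-- `κ` times the distribution `b` can be split off from the distribution `a` exactly when it is
dominated by `a`. -/
lemma exists_stdSimplex_eq_iff {L : ℕ} {a b : Fin L → ℝ} (ha : a ∈ stdSimplex ℝ (Fin L))
    (hb : b ∈ stdSimplex ℝ (Fin L)) {κ : ℝ} (hκ : κ ≤ 1) :
    (∃ g ∈ stdSimplex ℝ (Fin L), a = (1 - κ) • g + κ • b) ↔ ∀ i, κ * b i ≤ a i := by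
  constructor
  · rintro ⟨g, hg, rfl⟩ i
    have := mul_nonneg (sub_nonneg.2 hκ) (hg.1 i)
    simpa using this
  · intro h
    rcases hκ.lt_or_eq with hlt | rfl
    · have hpos : 0 < 1 - κ := sub_pos.2 hlt
      refine ⟨fun i => (a i - κ * b i) / (1 - κ),
        ⟨fun i => div_nonneg (sub_nonneg.2 (h i)) hpos.le, ?_⟩, ?_⟩
      · rw [← Finset.sum_div, Finset.sum_sub_distrib, ← Finset.mul_sum, ha.2, hb.2, mul_one,
          div_self hpos.ne']
      · ext i
        simp only [Pi.add_apply, Pi.smul_apply, smul_eq_mul]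
        rw [mul_div_cancel₀ _ hpos.ne', sub_add_cancel]
    · refine ⟨b, hb, ?_⟩
      have hsum : ∑ i, b i = ∑ i, a i := by rw [ha.2, hb.2]
      have heq := (Finset.sum_eq_sum_iff_of_le fun i _ => by simpa using h i).1 hsum
      ext i
      simp [heq i (Finset.mem_univ i)]

/-- `κ*(a | b)` is the minimum of the likelihood ratio `a / b` over the support of `b`. -/
lemma kappaTwoVec_eq_inf' {L : ℕ} {a b : Fin L → ℝ} (ha : a ∈ stdSimplex ℝ (Fin L))
    (hb : b ∈ stdSimplex ℝ (Fin L)) (hne : (Finset.univ.filter fun i => 0 < b i).Nonempty) :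
    kappaTwoVec a b = (Finset.univ.filter fun i => 0 < b i).inf' hne fun i => a i / b i := by
  set m := (Finset.univ.filter fun i => 0 < b i).inf' hne fun i => a i / b i
  have hdom : ∀ i, m * b i ≤ a i := by
    intro i
    rcases (hb.1 i).lt_or_eq with hi | hi
    · rw [← le_div_iff₀ hi]
      exact Finset.inf'_le (fun i => a i / b i) (by simpa using hi)
    · rw [← hi, mul_zero]
      exact ha.1 i
  have hm0 : 0 ≤ m := Finset.le_inf' _ _ fun i _ => div_nonneg (ha.1 i) (hb.1 i)
  have hm1 : m ≤ 1 := by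
    have := Finset.sum_le_sum fun i (_ : i ∈ Finset.univ) => hdom i
    rwa [← Finset.mul_sum, ha.2, hb.2, mul_one] at this
  refine IsGreatest.csSup_eq ⟨⟨⟨hm0, hm1⟩, (exists_stdSimplex_eq_iff ha hb hm1).2 hdom⟩, ?_⟩
  rintro κ ⟨hκ, hg⟩
  refine Finset.le_inf' _ _ fun i hi => ?_
  rw [le_div_iff₀ (by simpa using hi)]
  exact (exists_stdSimplex_eq_iff ha hb hκ.2).1 hg i

/-- For distinct `η₁, η₂, η₃ ∈ Δ_L` and `α_n ∈ [0,1]` with `α_n → 1`,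
`κ*(α_n η₂ + (1 − α_n) η₃ | η₁) → κ*(η₂ | η₁)`. -/
theorem stmt9 {L : ℕ} (η₁ η₂ η₃ : Fin L → ℝ)
    (hη₁ : η₁ ∈ stdSimplex ℝ (Fin L)) (hη₂ : η₂ ∈ stdSimplex ℝ (Fin L))
    (hη₃ : η₃ ∈ stdSimplex ℝ (Fin L))
    (h12 : η₁ ≠ η₂) (h13 : η₁ ≠ η₃) (h23 : η₂ ≠ η₃)
    (α : ℕ → ℝ) (hα : ∀ n, α n ∈ Set.Icc (0 : ℝ) 1)
    (hαlim : Tendsto α atTop (nhds 1)) :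
    Tendsto (fun n => kappaTwoVec (α n • η₂ + (1 - α n) • η₃) η₁) atTop
      (nhds (kappaTwoVec η₂ η₁)) := by
  have hne : (Finset.univ.filter fun i => 0 < η₁ i).Nonempty := by
    obtain ⟨i, hi, hpos⟩ := Finset.exists_lt_of_sum_lt
      (show ∑ _i : Fin L, (0 : ℝ) < ∑ i, η₁ i by simp [hη₁.2])
    exact ⟨i, by simpa using hpos⟩
  have hmix : ∀ n, α n • η₂ + (1 - α n) • η₃ ∈ stdSimplex ℝ (Fin L) := fun n =>
    convex_stdSimplex ℝ (Fin L) hη₂ hη₃ (hα n).1 (sub_nonneg.2 (hα n).2) (by ring)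
  simp only [fun n => kappaTwoVec_eq_inf' (hmix n) hη₁ hne]
  rw [kappaTwoVec_eq_inf' hη₂ hη₁ hne]
  refine Tendsto.finset_inf'_nhds_apply hne fun i _ => Tendsto.div_const ?_ _
  simpa using (hαlim.mul_const (η₂ i)).add ((hαlim.const_sub 1).mul_const (η₃ i))
end

section
/- Let τ₁, …, τ_K ∈ Δ_L be linearly independent and let k ≤ K. Let τ* be a point in the relative interior of co(τ₁, …, τ_k), and for each i = 1, …, k let η_i be a point in the relative interior of the segment co(τ_i, τ*) (i.e., η_i = (1−β_i)τ_i + β_i τ* for some β_i ∈ (0,1)). Then η₁, …, η_k, τ_{k+1}, …, τ_K are linearly independent. -/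
/-- If `y` is a nonnegative combination of linearly independent vectors `v i`, then moving every
`v i` a proportion `b i ∈ [0, 1)` of the way towards `y` preserves linear independence. -/
theorem LinearIndependent.convexComb_nonneg_combination {ι E : Type*} [Fintype ι]
    [AddCommGroup E] [Module ℝ E] {v : ι → E} (hv : LinearIndependent ℝ v)
    {w b : ι → ℝ} (hw : ∀ i, 0 ≤ w i) (hb₀ : ∀ i, 0 ≤ b i) (hb₁ : ∀ i, b i < 1) :
    LinearIndependent ℝ (fun i => (1 - b i) • v i + b i • ∑ j, w j • v j) := by
  rw [Fintype.linearIndependent_iff] at hv ⊢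
  intro c hc
  have key : ∀ i, c i * (1 - b i) + (∑ j, c j * b j) * w i = 0 := by
    refine hv _ ?_
    rw [← hc]
    simp only [smul_add, add_smul, smul_smul, Finset.sum_add_distrib]
    rw [← Finset.sum_smul, Finset.smul_sum]
    simp only [smul_smul]
  have hS : ∑ j, c j * b j = 0 := by
    rcases lt_trichotomy (∑ j, c j * b j) 0 with h | h | h
    · refine absurd (Finset.sum_nonneg fun j _ => mul_nonneg ?_ (hb₀ j)) h.not_ge
      by_contra! hcj
      nlinarith [key j, mul_nonpos_of_nonpos_of_nonneg h.le (hw j),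
        mul_neg_of_neg_of_pos hcj (sub_pos.2 (hb₁ j))]
    · exact h
    · refine absurd (Finset.sum_nonpos fun j _ => mul_nonpos_of_nonpos_of_nonneg ?_ (hb₀ j))
        h.not_ge
      by_contra! hcj
      nlinarith [key j, mul_nonneg h.le (hw j), mul_pos hcj (sub_pos.2 (hb₁ j))]
  intro i
  have h := key i
  rw [hS, zero_mul, add_zero] at h
  exact (mul_eq_zero.1 h).resolve_right (sub_pos.2 (hb₁ i)).ne'

/-- Let `τ₁, …, τ_K ∈ Δ_L` be linearly independent and `k ≤ K`. Let `τ*`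
be a point of the relative interior of `co(τ₁, …, τ_k)`, and for each `i < k` let
`η i = (1 − β i) • τ i + β i • τ*` with `β i ∈ (0,1)` (a point of the relative interior of
the segment `co(τ i, τ*)`). Then `η₁, …, η_k, τ_{k+1}, …, τ_K` are linearly independent. -/
theorem stmt12 {K L : ℕ} (τ : Fin K → Fin L → ℝ)
    (hτΔ : ∀ i, τ i ∈ stdSimplex ℝ (Fin L))
    (hτind : LinearIndependent ℝ τ)
    (k : ℕ) (hk : k ≤ K)
    (τstar : Fin L → ℝ)
    (hτstar : τstar ∈ intrinsicInterior ℝ (convexHull ℝ (τ '' {i : Fin K | (i : ℕ) < k})))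
    (η : Fin K → Fin L → ℝ) (β : Fin K → ℝ)
    (hβ : ∀ i : Fin K, (i : ℕ) < k → β i ∈ Set.Ioo (0 : ℝ) 1)
    (hη : ∀ i : Fin K, (i : ℕ) < k → η i = (1 - β i) • τ i + β i • τstar) :
    LinearIndependent ℝ (fun i : Fin K => if (i : ℕ) < k then η i else τ i) := by
  have hmem : τstar ∈ convexHull ℝ (Set.range τ) :=
    convexHull_mono (Set.image_subset_range _ _) (intrinsicInterior_subset hτstar)
  obtain ⟨w, hw, rfl⟩ : ∃ w : Fin K → ℝ, (∀ i, 0 ≤ w i) ∧ ∑ i, w i • τ i = τstar := by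
    refine convexHull_min (t := {x | ∃ w : Fin K → ℝ, (∀ i, 0 ≤ w i) ∧ ∑ i, w i • τ i = x})
      ?_ ?_ hmem
    · rintro _ ⟨i, rfl⟩
      exact ⟨Pi.single i 1, fun j => (Pi.single_nonneg.2 zero_le_one : (0 : Fin K → ℝ) ≤ _) j,
        by simp [Pi.single_apply]⟩
    · rintro _ ⟨u, hu, rfl⟩ _ ⟨v, hv, rfl⟩ a b ha hb -
      exact ⟨fun i => a * u i + b * v i,
        fun i => add_nonneg (mul_nonneg ha (hu i)) (mul_nonneg hb (hv i)),
        by simp only [add_smul, mul_smul, Finset.sum_add_distrib, Finset.smul_sum]⟩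
  have hcomb := hτind.convexComb_nonneg_combination hw
    (b := fun i => if (i : ℕ) < k then β i else 0)
    (fun i => by
      split_ifs with hi
      exacts [(hβ i hi).1.le, le_rfl])
    (fun i => by
      split_ifs with hi
      exacts [(hβ i hi).2, one_pos])
  have heq : (fun i : Fin K => if (i : ℕ) < k then η i else τ i) = fun i : Fin K =>
      (1 - if (i : ℕ) < k then β i else 0) • τ i +
        (if (i : ℕ) < k then β i else 0) • ∑ j, w j • τ j := by
    funext i
    split_ifs with hi
    · exact hη i hi
    · simp
  rw [heq]
  exact hcomb
end

section
/- Let P₁, …, P_L be jointly irreducible probability distributions and let i₁, …, i_K be distinct indices in {1, …, L}. Let (Q₁, …, Q_{K−1}) be a permutation of (P_{i₁}, …, P_{i_{K−1}}), and let Q_K¹ = ∑_{t=1}^K λ_t P_{i_t} where λ_t > 0 for all t and ∑_{t=1}^K λ_t = 1 (i.e., Q_K¹ lies in the relative interior of co(P_{i₁}, …, P_{i_K})). For m = 2, …, K define Q_K^m to be the residue of Q_K^{m−1} with respect to Q_{m−1}. Then Q_K^K = P_{i_K}. -/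
open MeasureTheory

section MixtureOfProbabilityMeasures

variable {X : Type*} [MeasurableSpace X] {L : ℕ} (P : Fin L → Measure X)
  [∀ j, IsProbabilityMeasure (P j)]

lemma sum_smul_toSignedMeasure_univ (γ : Fin L → ℝ) :
    (∑ i, γ i • (P i).toSignedMeasure) Set.univ = ∑ i, γ i := by
  simp

lemma sum_coeff_eq_one {F : Measure X} [IsProbabilityMeasure F] {γ : Fin L → ℝ}
    (hF : F.toSignedMeasure = ∑ i, γ i • (P i).toSignedMeasure) : ∑ i, γ i = 1 := by
  rw [← sum_smul_toSignedMeasure_univ P γ, ← hF]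
  simp

lemma exists_isProbabilityMeasure_toSignedMeasure_eq_sum {c : Fin L → ℝ} (hc : ∀ i, 0 ≤ c i)
    (hsum : ∑ i, c i = 1) :
    ∃ (G : Measure X) (_ : IsProbabilityMeasure G),
      G.toSignedMeasure = ∑ i, c i • (P i).toSignedMeasure := by
  have hG : IsProbabilityMeasure (∑ i, ENNReal.ofReal (c i) • P i) := by
    constructor
    simp [Measure.finsetSum_apply, ← ENNReal.ofReal_sum_of_nonneg fun i _ => hc i, hsum]
  refine ⟨_, hG, ?_⟩
  ext s hs
  rw [Measure.toSignedMeasure_apply_measurable hs]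
  simp only [FunLike.coe_sum, Finset.sum_apply, smul_apply,
    Measure.toSignedMeasure_apply_measurable hs, measureReal_def, Measure.finsetSum_apply,
    Measure.smul_apply, smul_eq_mul]
  rw [ENNReal.toReal_sum fun i _ => ENNReal.mul_ne_top ENNReal.ofReal_ne_top (measure_ne_top _ _)]
  simp [ENNReal.toReal_mul, ENNReal.toReal_ofReal, hc]

variable {P}

namespace JointlyIrreducible

lemma eq_zero_of_sum_smul_eq_zero (hP : JointlyIrreducible P) {β : Fin L → ℝ}
    (hβ : ∑ i, β i • (P i).toSignedMeasure = 0) (i : Fin L) : β i = 0 := by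
  have key (c : ℝ) (j k : Fin L) : 0 ≤ (Pi.single j 1 : Fin L → ℝ) k + c * β k := by
    refine hP (fun k => (Pi.single j 1 : Fin L → ℝ) k + c * β k) (P j) inferInstance ?_ k
    simp [add_smul, mul_smul, Finset.sum_add_distrib, ← Finset.smul_sum, hβ, Pi.single_apply,
      ite_smul]
  by_contra h
  have := key (-2 / β i) i i
  rw [div_mul_cancel₀ _ h, Pi.single_eq_same] at this
  linarith

lemma coeff_unique_s13 (hP : JointlyIrreducible P) {γ δ : Fin L → ℝ}
    (h : ∑ i, γ i • (P i).toSignedMeasure = ∑ i, δ i • (P i).toSignedMeasure) : γ = δ := by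
  funext i
  have hsub : ∑ i, (γ i - δ i) • (P i).toSignedMeasure = 0 := by
    rw [← sub_eq_zero.2 h, ← Finset.sum_sub_distrib]
    exact Finset.sum_congr rfl fun i _ => sub_smul (γ i) (δ i) (P i).toSignedMeasure
  exact sub_eq_zero.1 (hP.eq_zero_of_sum_smul_eq_zero hsub i)

end JointlyIrreducible

/-- Removing the `j`-th component of a mixture and renormalising. -/
lemma toSignedMeasure_eq_sum_of_remove {F G : Measure X} [IsProbabilityMeasure F]
    [IsProbabilityMeasure G] {γ : Fin L → ℝ} {j : Fin L} {κ : ℝ} (hκ : κ ≠ 1)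
    (hF : F.toSignedMeasure = ∑ i, γ i • (P i).toSignedMeasure)
    (h : F.toSignedMeasure = (1 - κ) • G.toSignedMeasure + κ • (P j).toSignedMeasure) :
    G.toSignedMeasure =
      ∑ i, ((1 - κ)⁻¹ * (γ i - (Pi.single j κ : Fin L → ℝ) i)) • (P i).toSignedMeasure := by
  have hne : 1 - κ ≠ 0 := sub_ne_zero.2 hκ.symm
  simp only [mul_smul, ← Finset.smul_sum, sub_smul, Finset.sum_sub_distrib, ← hF,
    Pi.single_apply, ite_smul, zero_smul, Finset.sum_ite_eq', Finset.mem_univ, if_true]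
  rw [h, add_sub_cancel_right, smul_smul, inv_mul_cancel₀ hne, one_smul]

lemma JointlyIrreducible.kappaTwo_eq (hP : JointlyIrreducible P) {F : Measure X}
    [IsProbabilityMeasure F] {γ : Fin L → ℝ} (hγ : ∀ i, 0 ≤ γ i)
    (hF : F.toSignedMeasure = ∑ i, γ i • (P i).toSignedMeasure) {j : Fin L} (hj : γ j < 1) :
    kappaTwo F (P j) = γ j := by
  have hpos : 0 < 1 - γ j := sub_pos.2 hj
  refine IsGreatest.csSup_eq ⟨⟨⟨hγ j, hj.le⟩, ?_⟩, ?_⟩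
  · obtain ⟨G, hG, hGe⟩ := exists_isProbabilityMeasure_toSignedMeasure_eq_sum P
      (c := fun i => (1 - γ j)⁻¹ * (γ i - (Pi.single j (γ j) : Fin L → ℝ) i)) (fun i => by
        refine mul_nonneg (inv_nonneg.2 hpos.le) ?_
        rcases eq_or_ne i j with rfl | h
        · simp
        · simpa [h] using hγ i) (by
        rw [← Finset.mul_sum, Finset.sum_sub_distrib, sum_coeff_eq_one P hF,
          Finset.sum_pi_single', if_pos (Finset.mem_univ _), inv_mul_cancel₀ hpos.ne'])
    refine ⟨G, hG, ?_⟩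
    rw [hGe, hF]
    simp only [mul_smul, ← Finset.smul_sum, sub_smul, Finset.sum_sub_distrib,
      Pi.single_apply, ite_smul, zero_smul, Finset.sum_ite_eq', Finset.mem_univ, if_true]
    rw [smul_smul, mul_inv_cancel₀ hpos.ne', one_smul, sub_add_cancel]
  · rintro κ ⟨⟨-, hκ1⟩, G, hG, h⟩
    rcases hκ1.eq_or_lt with rfl | hκ
    · have : γ = Pi.single j 1 := hP.coeff_unique_s13 <| by
        rw [← hF, h]
        simp [Pi.single_apply, ite_smul]
      simp [this] at hj
    · have := hP _ G hG (toSignedMeasure_eq_sum_of_remove hκ.ne hF h) j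
      rw [Pi.single_eq_same] at this
      have := nonneg_of_mul_nonneg_right this (inv_pos.2 (sub_pos.2 hκ))
      linarith

end MixtureOfProbabilityMeasures

/-- with `K = n + 1`. Let `P₁, …, P_L` be jointly irreducible and
`ι : Fin (n+1) ↪ Fin L` give distinct indices `i₁, …, i_K`. Let `(Q₁, …, Q_{K−1})` be a
permutation of `(P_{i₁}, …, P_{i_{K−1}})`, and let `S 0 = Q_K¹ = ∑ₜ λ t • P (ι t)` with all
`λ t > 0` summing to `1`. For each `m`, `S (m+1)` is the residue of `S m` with respect to
`Q m`. Then `S K = P (ι K)`, i.e. `Q_K^K = P_{i_K}`. -/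
theorem stmt13 {X : Type*} [MeasurableSpace X] {L n : ℕ}
    (P : Fin L → Measure X) [∀ j, IsProbabilityMeasure (P j)]
    (hJI : JointlyIrreducible P)
    (ι : Fin (n + 1) → Fin L) (hι : Function.Injective ι)
    (σ : Equiv.Perm (Fin n))
    (Q : Fin n → Measure X) [∀ m, IsProbabilityMeasure (Q m)] (hQ : ∀ m, Q m = P (ι (Fin.castSucc (σ m))))
    (lam : Fin (n + 1) → ℝ) (hlampos : ∀ t, 0 < lam t) (hlamsum : ∑ t, lam t = 1)
    (S : Fin (n + 1) → Measure X) [∀ m, IsProbabilityMeasure (S m)]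
    (hS0 : (S 0).toSignedMeasure = ∑ t, lam t • (P (ι t)).toSignedMeasure)
    (hstep : ∀ m : Fin n,
      (S (Fin.castSucc m)).toSignedMeasure
        = (1 - kappaTwo (S (Fin.castSucc m)) (Q m)) • (S (Fin.succ m)).toSignedMeasure
          + kappaTwo (S (Fin.castSucc m)) (Q m) • (Q m).toSignedMeasure) :
    S (Fin.last n) = P (ι (Fin.last n)) := by
  have invariant (m : Fin (n + 1)) : ∃ γ : Fin L → ℝ, (∀ i, 0 ≤ γ i) ∧ 0 < γ (ι (Fin.last n)) ∧
      (∀ i ∉ Set.range ι, γ i = 0) ∧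
      (∀ k : Fin n, k.castSucc < m → γ (ι (σ k).castSucc) = 0) ∧
      (S m).toSignedMeasure = ∑ i, γ i • (P i).toSignedMeasure := by
    induction m using Fin.induction with
    | zero =>
      have hext (t) : Function.extend ι lam (0 : Fin L → ℝ) (ι t) = lam t := hι.extend_apply lam _ t
      have hout (i) (hi : i ∉ Set.range ι) : Function.extend ι lam (0 : Fin L → ℝ) i = 0 :=
        Function.extend_apply' lam _ i hi
      refine ⟨Function.extend ι lam (0 : Fin L → ℝ), fun i => ?_, ?_, hout, fun k hk => ?_, ?_⟩
      · by_cases hi : i ∈ Set.range ι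
        · obtain ⟨t, rfl⟩ := hi
          exact (hext t).symm ▸ (hlampos t).le
        · exact (hout i hi).ge
      · exact (hext _).symm ▸ hlampos _
      · exact absurd hk (Fin.not_lt_zero _)
      · rw [hS0]
        refine Fintype.sum_of_injective ι hι _ _ (fun i hi => ?_) fun t => ?_
        · rw [hout i hi, zero_smul]
        · rw [hext]
    | succ m ih =>
      obtain ⟨γ, hnn, hlast, hout, hzero, heq⟩ := ih
      set j := ι (σ m).castSucc with hj
      have hjl : ι (Fin.last n) ≠ j := fun h => (Fin.castSucc_lt_last (σ m)).ne (hι h).symm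
      have hj1 : γ j < 1 := by
        have h := Finset.add_le_sum (fun i _ => hnn i) (Finset.mem_univ (ι (Fin.last n)))
          (Finset.mem_univ j) hjl
        rw [sum_coeff_eq_one P heq] at h
        linarith
      have hκ : kappaTwo (S m.castSucc) (Q m) = γ j := by
        simp only [hQ m]
        exact hJI.kappaTwo_eq hnn heq hj1
      have hres := hstep m
      rw [hκ] at hres
      simp only [hQ m] at hres
      have hinv : 0 < (1 - γ j)⁻¹ := inv_pos.2 (sub_pos.2 hj1)
      have hcoeff {i} (hi : i ≠ j) : γ i - (Pi.single j (γ j) : Fin L → ℝ) i = γ i := by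
        simp [hi]
      have hcoeff_self : γ j - (Pi.single j (γ j) : Fin L → ℝ) j = 0 := by simp
      refine ⟨_, fun i => mul_nonneg hinv.le ?_, mul_pos hinv ?_, fun i hi => ?_, fun k hk => ?_,
        toSignedMeasure_eq_sum_of_remove hj1.ne heq hres⟩
      · rcases eq_or_ne i j with rfl | h
        · exact hcoeff_self.ge
        · exact (hcoeff h).symm ▸ hnn i
      · rwa [hcoeff hjl]
      · have : i ≠ j := fun h => hi ⟨_, h.symm⟩
        rw [hcoeff this, hout i hi, mul_zero]
      · rcases eq_or_ne k m with rfl | h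
        · rw [← hj, hcoeff_self, mul_zero]
        · have hkj : ι (σ k).castSucc ≠ j := fun e =>
            h (σ.injective (Fin.castSucc_injective n (hι e)))
          have hkm : k.castSucc < m.castSucc :=
            lt_of_le_of_ne (Fin.castSucc_lt_succ_iff.1 hk) ((Fin.castSucc_injective n).ne h)
          rw [hcoeff hkj, hzero k hkm, mul_zero]
  obtain ⟨γ, -, -, hout, hzero, heq⟩ := invariant (Fin.last n)
  have hother (i) (hi : i ≠ ι (Fin.last n)) : γ i = 0 := by
    by_cases h : i ∈ Set.range ι
    · obtain ⟨t, rfl⟩ := h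
      induction t using Fin.lastCases with
      | last => exact absurd rfl hi
      | cast t => simpa using hzero (σ.symm t) (Fin.castSucc_lt_last _)
    · exact hout i h
  have hone : γ (ι (Fin.last n)) = 1 := by
    rw [← sum_coeff_eq_one P heq]
    exact (Fintype.sum_eq_single _ hother).symm
  rw [Fintype.sum_eq_single _ fun i hi => by rw [hother i hi, zero_smul], hone, one_smul] at heq
  exact Measure.toSignedMeasure_eq_toSignedMeasure_iff.1 heq
end

section
/- Let P₁, …, P_K be jointly irreducible probability distributions and let Q₁, …, Q_K be distinct probability distributions with Q_i = ∑_{k=1}^K η_{i,k} P_k for η_i ∈ Δ_K. For i ≠ j let R_{i,j} denote the residue of Q_i with respect to Q_j. Then the following are equivalent: (a) S(η₁) = S(η₂) = ⋯ = S(η_K), i.e., all Q_i lie in the relative interior of the same face of the simplex; (b) for all i ≠ j, κ*(Q_i | R_{i,j}) < 1. -/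
open MeasureTheory

section KappaTwo

variable {X : Type*} [MeasurableSpace X]

theorem kappaTwo_bddAbove (F₀ F₁ : Measure X) [IsFiniteMeasure F₀] [IsFiniteMeasure F₁] :
    BddAbove {κ : ℝ | κ ∈ Set.Icc (0 : ℝ) 1 ∧ ∃ (G : Measure X) (_ : IsProbabilityMeasure G),
      F₀.toSignedMeasure = (1 - κ) • G.toSignedMeasure + κ • F₁.toSignedMeasure} :=
  ⟨1, fun _ h => h.1.2⟩

theorem kappaTwo_self (F : Measure X) [IsProbabilityMeasure F] : kappaTwo F F = 1 :=
  le_antisymm (Real.sSup_le (fun _ h => h.1.2) zero_le_one)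
    (le_csSup (kappaTwo_bddAbove F F) ⟨by simp, F, inferInstance, by simp⟩)

theorem kappaTwo_nonneg (F₀ F₁ : Measure X) [IsFiniteMeasure F₀] [IsFiniteMeasure F₁] :
    0 ≤ kappaTwo F₀ F₁ :=
  Real.sSup_nonneg fun _ h => h.1.1

theorem exists_decomposition_of_lt_kappaTwo {F₀ F₁ : Measure X} [IsProbabilityMeasure F₀]
    [IsFiniteMeasure F₁] {c : ℝ} (hc : c < kappaTwo F₀ F₁) :
    ∃ κ ∈ Set.Icc (0 : ℝ) 1, c < κ ∧ ∃ (G : Measure X) (_ : IsProbabilityMeasure G),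
      F₀.toSignedMeasure = (1 - κ) • G.toSignedMeasure + κ • F₁.toSignedMeasure := by
  obtain ⟨κ, ⟨h1, h2⟩, h3⟩ :=
    exists_lt_of_lt_csSup (by exact ⟨0, by simp, F₀, inferInstance, by simp⟩) hc
  exact ⟨κ, h1, h3, h2⟩

/-- Two probability measures whose two-sample `κ*` is at least one coincide. -/
theorem eq_of_one_le_kappaTwo {F₀ F₁ : Measure X} [IsProbabilityMeasure F₀]
    [IsProbabilityMeasure F₁] (h : 1 ≤ kappaTwo F₀ F₁) : F₀ = F₁ := by
  have key : ∀ A, MeasurableSet A → F₁.real A ≤ F₀.real A := by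
    intro A hA
    refine le_of_forall_pos_lt_add fun ε hε => ?_
    obtain ⟨κ, hκ, hlt, G, hG, hF⟩ :=
      exists_decomposition_of_lt_kappaTwo (c := 1 - ε) (by linarith : 1 - ε < kappaTwo F₀ F₁)
    have h1 := congrArg (fun s : SignedMeasure X => s A) hF
    simp only [Measure.toSignedMeasure_apply_measurable hA, add_apply,
      smul_apply, smul_eq_mul] at h1
    have h2 : 0 ≤ G.real A := measureReal_nonneg
    have h3 : F₁.real A ≤ 1 := measureReal_le_one
    have h4 : 0 ≤ F₁.real A := measureReal_nonneg
    have h5 := mul_nonneg (sub_nonneg.2 hκ.2) h2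
    have h6 := mul_le_of_le_one_right (sub_nonneg.2 hκ.2) h3
    linarith
  refine Measure.ext fun A hA => ?_
  have h1 := key A hA
  have h2 := key Aᶜ hA.compl
  rw [probReal_compl_eq_one_sub hA, probReal_compl_eq_one_sub hA] at h2
  exact (measureReal_eq_measureReal_iff).1 (by linarith)

/-- A convex combination of probability measures is a probability measure. -/
theorem exists_isProbabilityMeasure_eq_sum {ι : Type*} [Fintype ι] (P : ι → Measure X)
    [∀ k, IsProbabilityMeasure (P k)] {c : ι → ℝ} (hc : c ∈ stdSimplex ℝ ι) :
    ∃ (G : Measure X) (_ : IsProbabilityMeasure G),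
      G.toSignedMeasure = ∑ k, c k • (P k).toSignedMeasure := by
  have hG : IsProbabilityMeasure (∑ k, ENNReal.ofReal (c k) • P k) := by
    constructor
    simp [Measure.finsetSum_apply, ← ENNReal.ofReal_sum_of_nonneg fun k _ => hc.1 k, hc.2]
  refine ⟨_, hG, ?_⟩
  ext A hA
  rw [Measure.toSignedMeasure_apply_measurable hA, sum_apply, measureReal_def,
    Measure.finsetSum_apply, ENNReal.toReal_sum (fun k _ => by
      simpa using ENNReal.mul_ne_top ENNReal.ofReal_ne_top (measure_ne_top _ _))]
  refine Finset.sum_congr rfl fun k _ => ?_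
  simp [Measure.toSignedMeasure_apply_measurable hA, measureReal_def, hc.1 k]

/-- For distinct mixtures of jointly irreducible distributions, `κ*` is positive exactly when
the supports of the mixing weights are nested. -/
theorem JointlyIrreducible.kappaTwo_pos_iff {K : ℕ} {P : Fin K → Measure X}
    [∀ k, IsProbabilityMeasure (P k)] (hP : JointlyIrreducible P)
    {F₀ F₁ : Measure X} [IsProbabilityMeasure F₀] [IsProbabilityMeasure F₁] (hne : F₀ ≠ F₁)
    {a b : Fin K → ℝ} (ha : a ∈ stdSimplex ℝ (Fin K)) (hb : b ∈ stdSimplex ℝ (Fin K))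
    (hF₀ : F₀.toSignedMeasure = ∑ k, a k • (P k).toSignedMeasure)
    (hF₁ : F₁.toSignedMeasure = ∑ k, b k • (P k).toSignedMeasure) :
    0 < kappaTwo F₀ F₁ ↔ {k | 0 < b k} ⊆ {k | 0 < a k} := by
  constructor
  · intro h k hk
    obtain ⟨κ, hκ, hpos, G, hG, hF⟩ := exists_decomposition_of_lt_kappaTwo h
    have hκ1 : κ ≠ 1 := by
      rintro rfl
      exact hne (Measure.toSignedMeasure_eq_toSignedMeasure_iff.1 (by simpa using hF))
    have hκ' : 0 < 1 - κ := sub_pos.2 (lt_of_le_of_ne hκ.2 hκ1)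
    have hGsum : G.toSignedMeasure
        = ∑ k, ((1 - κ)⁻¹ * (a k - κ * b k)) • (P k).toSignedMeasure := by
      have h1 : (1 - κ) • G.toSignedMeasure = F₀.toSignedMeasure - κ • F₁.toSignedMeasure :=
        eq_sub_of_add_eq hF.symm
      rw [← inv_smul_smul₀ hκ'.ne' G.toSignedMeasure, h1, hF₀, hF₁]
      simp only [mul_smul, sub_smul, Finset.smul_sum, Finset.sum_sub_distrib, smul_sub]
    have h2 := hP _ G hG hGsum k
    have h3 : 0 ≤ a k - κ * b k := nonneg_of_mul_nonneg_right h2 (inv_pos.2 hκ')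
    have h4 := mul_pos hpos hk
    exact h4.trans_le (sub_nonneg.1 h3)
  · intro h
    obtain ⟨κ, hκ0, hκ1, hκ⟩ : ∃ κ : ℝ, 0 < κ ∧ κ < 1 ∧ ∀ k, κ * b k ≤ a k := by
      have hev : ∀ k, ∀ᶠ κ : ℝ in nhdsWithin 0 (Set.Ioi 0), κ * b k ≤ a k := by
        intro k
        rcases (hb.1 k).eq_or_lt with h0 | h0
        · simpa [← h0] using ha.1 k
        · have hlim : Filter.Tendsto (fun κ : ℝ => κ * b k) (nhdsWithin 0 (Set.Ioi 0))
              (nhds (0 * b k)) :=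
            ((continuous_id.mul continuous_const).tendsto (0 : ℝ)).mono_left nhdsWithin_le_nhds
          rw [zero_mul] at hlim
          exact hlim.eventually (ge_mem_nhds (h h0))
      obtain ⟨κ, h1, h2⟩ := ((Filter.eventually_all.2 hev).and
        (Ioo_mem_nhdsGT (zero_lt_one' ℝ))).exists
      exact ⟨κ, h2.1, h2.2, h1⟩
    have hκ' : 0 < 1 - κ := sub_pos.2 hκ1
    obtain ⟨G, hG, hGsum⟩ := exists_isProbabilityMeasure_eq_sum P
      (c := fun k => (1 - κ)⁻¹ * (a k - κ * b k))
      ⟨fun k => mul_nonneg (inv_nonneg.2 hκ'.le) (sub_nonneg.2 (hκ k)), by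
        rw [← Finset.mul_sum, Finset.sum_sub_distrib, ← Finset.mul_sum, ha.2, hb.2, mul_one,
          inv_mul_cancel₀ hκ'.ne']⟩
    refine hκ0.trans_le (le_csSup (kappaTwo_bddAbove F₀ F₁) ⟨⟨hκ0.le, hκ1.le⟩, G, hG, ?_⟩)
    rw [hGsum, hF₀, hF₁]
    simp only [mul_smul, sub_smul, ← Finset.smul_sum, Finset.sum_sub_distrib]
    rw [smul_inv_smul₀ hκ'.ne', sub_add_cancel]

/-- If `R` is a residue of `F₀` with respect to a different distribution `F₁`, then
`κ*(F₀ | R) < 1` exactly when `κ*(F₀ | F₁)` is positive. -/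
theorem kappaTwo_residue_lt_one_iff {F₀ F₁ R : Measure X} [IsProbabilityMeasure F₀]
    [IsProbabilityMeasure F₁] [IsProbabilityMeasure R] (hne : F₀ ≠ F₁)
    (hR : F₀.toSignedMeasure = (1 - kappaTwo F₀ F₁) • R.toSignedMeasure
      + kappaTwo F₀ F₁ • F₁.toSignedMeasure) :
    kappaTwo F₀ R < 1 ↔ 0 < kappaTwo F₀ F₁ := by
  constructor
  · intro h
    refine (kappaTwo_nonneg F₀ F₁).lt_of_ne' fun h0 => ?_
    rw [h0] at hR
    obtain rfl : F₀ = R :=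
      Measure.toSignedMeasure_eq_toSignedMeasure_iff.1 (by simpa using hR)
    exact h.ne (kappaTwo_self F₀)
  · intro h
    by_contra! h1
    obtain rfl := eq_of_one_le_kappaTwo h1
    refine hne (Measure.toSignedMeasure_eq_toSignedMeasure_iff.1 ?_)
    refine smul_right_injective _ h.ne' (?_ : kappaTwo F₀ F₁ • _ = kappaTwo F₀ F₁ • _)
    have h2 := sub_eq_of_eq_add' hR
    rw [← h2, sub_smul (1 : ℝ) (kappaTwo F₀ F₁) F₀.toSignedMeasure, one_smul, sub_sub_cancel]

end KappaTwo

/-- correctness of FaceTest. Let `P₁, …, P_K` be jointly irreducible and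
`Q₁, …, Q_K` distinct with `Q i = ∑ₖ η i k • P k`, `η i ∈ Δ_K`, and for `i ≠ j` let `R i j`
be the residue of `Q i` with respect to `Q j`. Then all the `η i` have the same support set
(i.e. all `Q i` lie in the relative interior of the same face of the simplex) iff
`κ*(Q i | R i j) < 1` for all `i ≠ j`. -/
theorem stmt14 {X : Type*} [MeasurableSpace X] {K : ℕ}
    (P : Fin K → Measure X) [∀ k, IsProbabilityMeasure (P k)]
    (hJI : JointlyIrreducible P)
    (Q : Fin K → Measure X) [∀ i, IsProbabilityMeasure (Q i)]
    (hQdist : Function.Injective Q)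
    (η : Fin K → Fin K → ℝ) (hηΔ : ∀ i, η i ∈ stdSimplex ℝ (Fin K))
    (hQ : ∀ i, (Q i).toSignedMeasure = ∑ k, η i k • (P k).toSignedMeasure)
    (R : Fin K → Fin K → Measure X) [∀ i j, IsProbabilityMeasure (R i j)]
    (hR : ∀ i j, i ≠ j → (Q i).toSignedMeasure
      = (1 - kappaTwo (Q i) (Q j)) • (R i j).toSignedMeasure
        + kappaTwo (Q i) (Q j) • (Q j).toSignedMeasure) :
    (∀ i j, {k | 0 < η i k} = {k | 0 < η j k}) ↔
      (∀ i j, i ≠ j → kappaTwo (Q i) (R i j) < 1) := by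
  have key : ∀ i j, i ≠ j →
      (kappaTwo (Q i) (R i j) < 1 ↔ {k | 0 < η j k} ⊆ {k | 0 < η i k}) := fun i j hij =>
    (kappaTwo_residue_lt_one_iff (hQdist.ne hij) (hR i j hij)).trans
      (hJI.kappaTwo_pos_iff (hQdist.ne hij) (hηΔ i) (hηΔ j) (hQ i) (hQ j))
  constructor
  · exact fun h i j hij => (key i j hij).2 (h j i).subset
  · intro h i j
    rcases eq_or_ne i j with rfl | hij
    · rfl
    · exact ((key j i hij.symm).1 (h j i hij.symm)).antisymm ((key i j hij).1 (h i j hij))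
end

section
/- Let B be an N×K matrix with entries in {0,1} having at least one nonzero entry and such that no two columns of B are identical. Then there exists a nonempty set of row indices {i₁, …, i_n} ⊆ {1, …, N} such that the entrywise minimum of the rows B_{i₁,:}, …, B_{i_n,:} is a vector with exactly one entry equal to 1 (all other entries equal to 0). -/
/-- If `B` is an `N × K` binary matrix with at least one nonzero entry and
no two identical columns, then some nonempty set of rows has entrywise minimum equal to a
standard basis vector: exactly one entry `1` and all other entries `0`. -/
theorem stmt16 {N K : ℕ} (B : Fin N → Fin K → ℕ)
    (hbin : ∀ i j, B i j = 0 ∨ B i j = 1)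
    (hnonzero : ∃ i j, B i j = 1)
    (hcols : ∀ j₁ j₂ : Fin K, (∀ i, B i j₁ = B i j₂) → j₁ = j₂) :
    ∃ (s : Finset (Fin N)) (hs : s.Nonempty) (j : Fin K),
      s.inf' hs (fun i => B i j) = 1 ∧
      ∀ j' : Fin K, j' ≠ j → s.inf' hs (fun i => B i j') = 0 := by
  obtain ⟨i₀, j₀, h₀⟩ := hnonzero
  let supp : Fin K → Finset (Fin N) := fun j => Finset.univ.filter (fun i => B i j = 1)
  have mem_supp : ∀ i j, i ∈ supp j ↔ B i j = 1 := fun i j => by simp [supp]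
  -- A column whose support has maximal cardinality is not dominated by any other column.
  obtain ⟨j, -, hmax⟩ :=
    Finset.exists_max_image Finset.univ (fun j => (supp j).card) ⟨j₀, Finset.mem_univ _⟩
  have hs : (supp j).Nonempty :=
    Finset.card_pos.mp <|
      (Finset.card_pos.mpr ⟨i₀, (mem_supp i₀ j₀).mpr h₀⟩).trans_le (hmax j₀ (Finset.mem_univ _))
  refine ⟨supp j, hs, j, ?_, fun j' hj' => ?_⟩
  · obtain ⟨i, hi, hinf⟩ := Finset.exists_mem_eq_inf' hs (fun i => B i j)
    exact hinf.trans ((mem_supp i j).mp hi)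
  · obtain ⟨i, hi, hi'⟩ : ∃ i ∈ supp j, i ∉ supp j' := by
      by_contra! hsub
      have heq : supp j = supp j' :=
        Finset.eq_of_subset_of_card_le hsub (hmax j' (Finset.mem_univ _))
      refine hj' (hcols j' j fun i => ?_)
      have hiff : B i j = 1 ↔ B i j' = 1 := by rw [← mem_supp, ← mem_supp, heq]
      have := hbin i j
      have := hbin i j'
      omega
    have hzero : B i j' = 0 := (hbin i j').resolve_right (mt (mem_supp i j').mpr hi')
    exact Nat.le_zero.mp ((Finset.inf'_le (fun i => B i j') hi).trans hzero.le)
end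

section
/- Let L ≥ 3 and let π₁, …, π_L ∈ Δ_L be linearly independent. Let i, j ∈ {1, …, L} with i ≠ j, and set B = co({π₁} ∪ {e_k : k ∉ {i, j}}) and C = co(π₂, …, π_L). Then if C ∩ B is nonempty, the affine dimension of C ∩ B (the dimension of the direction space of its affine span) is at most L−3. -/
open Submodule in
/-- A nonempty subset of a subspace `W` on which a linear functional is constantly equal to `1`
spans an affine subspace of dimension smaller than that of `W`. -/
theorem finrank_direction_affineSpan_lt {K E : Type*} [DivisionRing K] [AddCommGroup E]
    [Module K E] [FiniteDimensional K E] (W : Submodule K E) (f : E →ₗ[K] K) {A : Set E}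
    (hA : A.Nonempty) (hAW : A ⊆ W) (hf : ∀ x ∈ A, f x = 1) :
    Module.finrank K (affineSpan K A).direction < Module.finrank K W := by
  obtain ⟨x, hx⟩ := hA
  have hle : (affineSpan K A).direction ≤ W ⊓ LinearMap.ker f := by
    rw [direction_affineSpan, vectorSpan_def, span_le]
    rintro _ ⟨a, ha, b, hb, rfl⟩
    exact ⟨W.sub_mem (hAW ha) (hAW hb), by simp [hf a ha, hf b hb]⟩
  refine (finrank_mono hle).trans_lt (finrank_lt_finrank_of_lt ?_)
  refine lt_of_le_of_ne inf_le_left fun h => ?_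
  have hx' : x ∈ W ⊓ LinearMap.ker f := h.ge (hAW hx)
  have : f x = 0 := hx'.2
  simp [hf x hx] at this

/-- Let `L ≥ 3`, `π₁, …, π_L ∈ Δ_L` linearly independent, `i ≠ j`, and set
`B = co({π₁} ∪ {e_m : m ∉ {i, j}})` and `C = co(π₂, …, π_L)`. If `C ∩ B` is nonempty then
its affine dimension (the dimension of the direction of its affine span) is at most `L − 3`. -/
theorem stmt19 {L : ℕ} (hL : 3 ≤ L)
    (pi0 : Fin L → Fin L → ℝ)
    (hπΔ : ∀ m, pi0 m ∈ stdSimplex ℝ (Fin L))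
    (hπind : LinearIndependent ℝ pi0)
    (i j : Fin L) (hij : i ≠ j)
    (hL0 : (0 : ℕ) < L) :
    ∀ B C : Set (Fin L → ℝ),
      B = convexHull ℝ
        (insert (pi0 ⟨0, hL0⟩)
          ((fun m => (Pi.single m 1 : Fin L → ℝ)) '' {m | m ≠ i ∧ m ≠ j})) →
      C = convexHull ℝ (pi0 '' {m | m ≠ ⟨0, hL0⟩}) →
      (C ∩ B).Nonempty →
      Module.finrank ℝ (affineSpan ℝ (C ∩ B)).direction ≤ L - 3 := by
  intro B C hB hC hne
  set S : Set (Fin L → ℝ) := insert (pi0 ⟨0, hL0⟩)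
    ((fun m => (Pi.single m 1 : Fin L → ℝ)) '' {m | m ≠ i ∧ m ≠ j}) with hS
  set T : Set (Fin L → ℝ) := pi0 '' {m | m ≠ ⟨0, hL0⟩} with hT
  have hcard : S.ncard ≤ L - 1 := by
    have h1 : {m : Fin L | m ≠ i ∧ m ≠ j}.ncard = L - 2 := by
      have : {m : Fin L | m ≠ i ∧ m ≠ j} = ({i, j} : Set (Fin L))ᶜ := by ext; simp
      rw [this, Set.ncard_compl, Set.ncard_pair hij, Nat.card_fin]
    have h2 := Set.ncard_image_le (f := fun m => (Pi.single m 1 : Fin L → ℝ))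
      (Set.toFinite {m : Fin L | m ≠ i ∧ m ≠ j})
    rw [h1] at h2
    calc S.ncard ≤ _ + 1 := Set.ncard_insert_le _ _
      _ ≤ (L - 2) + 1 := Nat.add_le_add_right h2 1
      _ = L - 1 := by omega
  have hV : Module.finrank ℝ (Submodule.span ℝ S) ≤ L - 1 := by
    have : Fintype S := ((Set.toFinite _).insert _).fintype
    refine (finrank_span_le_card S).trans ?_
    rwa [← Set.ncard_eq_toFinset_card']
  have hW : Module.finrank ℝ ↥(Submodule.span ℝ S ⊓ Submodule.span ℝ T) <
      Module.finrank ℝ (Submodule.span ℝ S) := by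
    refine Submodule.finrank_lt_finrank_of_lt (lt_of_le_of_ne inf_le_left fun h => ?_)
    have hmem : pi0 ⟨0, hL0⟩ ∈ Submodule.span ℝ S ⊓ Submodule.span ℝ T :=
      h.ge (Submodule.subset_span (Set.mem_insert _ _))
    exact hπind.notMem_span_image (by simp) hmem.2
  have hsum : ∀ x ∈ C ∩ B, (∑ m, LinearMap.proj m : (Fin L → ℝ) →ₗ[ℝ] ℝ) x = 1 := by
    rintro x ⟨hx, -⟩
    have hΔ : C ⊆ stdSimplex ℝ (Fin L) := by
      rw [hC]
      refine convexHull_min ?_ (convex_stdSimplex ℝ (Fin L))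
      rintro _ ⟨m, -, rfl⟩
      exact hπΔ m
    simpa using (hΔ hx).2
  have hsub : C ∩ B ⊆ (Submodule.span ℝ S ⊓ Submodule.span ℝ T : Submodule ℝ (Fin L → ℝ)) := by
    rintro x ⟨hxC, hxB⟩
    rw [hC] at hxC
    rw [hB] at hxB
    exact ⟨convexHull_min Submodule.subset_span (Submodule.convex _) hxB,
      convexHull_min Submodule.subset_span (Submodule.convex _) hxC⟩
  have := finrank_direction_affineSpan_lt _ _ hne hsub hsum
  omega
end
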